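/- Let d be a prime and let k be a positive even integer such that d does not divide k/2. Then the ℓ²→ℓ² operator norm of Σ_{q,p ∈ ℤ/dℤ} E_{q,p}^{⊗k} on (ℂ^d)^{⊗k} is at most 2^{k/2} · d. -/

import Mathlib

open Matrix Complex

/-- `ω = exp(2πi/d)`. -/
noncomputable def omega (d : ℕ) : ℂ := Complex.exp (2 * Real.pi * Complex.I / d)

/-- The shift matrix `X` on `ℂ^d`, acting by `X|j⟩ = |j+1⟩` (indices mod `d`). -/
noncomputable def Xmat (d : ℕ) [NeZero d] : Matrix (ZMod d) (ZMod d) ℂ :=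
  Matrix.of fun i j => if i = j + 1 then 1 else 0

/-- The clock matrix `Z` on `ℂ^d`, acting by `Z|j⟩ = ω^j |j⟩`. -/
noncomputable def Zmat (d : ℕ) [NeZero d] : Matrix (ZMod d) (ZMod d) ℂ :=
  Matrix.diagonal fun j => omega d ^ (j.val)

/-- The displacement operator `D_{q,p} = e^{iπqp/d} X^q Z^p`. -/
noncomputable def Dmat (d : ℕ) [NeZero d] (q p : ℤ) : Matrix (ZMod d) (ZMod d) ℂ :=
  Complex.exp (Real.pi * Complex.I * q * p / d) • (Xmat d ^ q * Zmat d ^ p)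

/-- The displacement observable `E_{q,p} = χ D_{q,p} + χ̄ D_{−q,−p}`, with `χ = (1+i)/2`. -/
noncomputable def Emat (d : ℕ) [NeZero d] (q p : ℤ) : Matrix (ZMod d) (ZMod d) ℂ :=
  ((1 + Complex.I) / 2) • Dmat d q p + (starRingEnd ℂ ((1 + Complex.I) / 2)) • Dmat d (-q) (-p)

/-- The `k`-fold Kronecker power `E_{q,p}^{⊗k}` acting on `(ℂ^d)^{⊗k}`, with computational basis
indexed by `ℤ_d^k` (entries are products of the entries of the factors). -/
noncomputable def EtensorPow (d : ℕ) [NeZero d] (k : ℕ) (q p : ℤ) :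
    Matrix (Fin k → ZMod d) (Fin k → ZMod d) ℂ :=
  Matrix.of fun a b => ∏ t : Fin k, Emat d q p (a t) (b t)

namespace Matrix

/-- The Kronecker product of a family of square matrices. -/
def piKronecker {ι n R : Type*} [Fintype ι] [CommSemiring R] (M : ι → Matrix n n R) :
    Matrix (ι → n) (ι → n) R :=
  Matrix.of fun a b => ∏ t, M t (a t) (b t)

section PiKronecker

variable {ι n R : Type*} [Fintype ι] [CommSemiring R]

theorem piKronecker_mul [DecidableEq ι] [Fintype n] (M N : ι → Matrix n n R) :
    piKronecker M * piKronecker N = piKronecker fun t => M t * N t := by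
  ext a b
  simp only [piKronecker, mul_apply, of_apply, ← Finset.prod_mul_distrib]
  rw [Finset.prod_univ_sum, Fintype.piFinset_univ]

theorem piKronecker_smul (c : ι → R) (M : ι → Matrix n n R) :
    (piKronecker fun t => c t • M t) = (∏ t, c t) • piKronecker M := by
  ext a b
  simp [piKronecker, Finset.prod_mul_distrib]

theorem piKronecker_one [DecidableEq n] : piKronecker (fun _ : ι => (1 : Matrix n n R)) = 1 := by
  ext a b
  simp only [piKronecker, of_apply, one_apply, Finset.prod_ite_zero, Finset.prod_const_one,
    Finset.mem_univ, true_implies, funext_iff]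

theorem piKronecker_conjTranspose [StarRing R] (M : ι → Matrix n n R) :
    (piKronecker M)ᴴ = piKronecker fun t => (M t)ᴴ := by
  ext a b
  simp [piKronecker, conjTranspose_apply]

theorem piKronecker_sum [DecidableEq ι] {κ : Type*} [Fintype κ] (M : ι → κ → Matrix n n R) :
    (piKronecker fun t => ∑ u, M t u) = ∑ s : ι → κ, piKronecker fun t => M t (s t) := by
  ext a b
  simp only [piKronecker, of_apply, sum_apply]
  rw [Finset.prod_univ_sum, Fintype.piFinset_univ]

end PiKronecker

theorem zpow_eq_of_map_add {n R : Type*} [Fintype n] [DecidableEq n] [CommRing R]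
    (f : ℤ → Matrix n n R) (h0 : f 0 = 1) (hadd : ∀ a b, f (a + b) = f a * f b) (m : ℤ) :
    f 1 ^ m = f m := by
  have hnat : ∀ m : ℕ, f 1 ^ m = f m := fun m => by
    induction m with
    | zero => simp [h0]
    | succ m ih => rw [pow_succ, ih, ← hadd]; simp
  obtain ⟨m, rfl | rfl⟩ := m.eq_nat_or_neg
  · rw [zpow_natCast, hnat]
  · rw [zpow_neg_natCast, hnat]
    exact inv_eq_right_inv (by rw [← hadd, add_neg_cancel, h0])

end Matrix

theorem norm_sum_twisted_le {B : Type*} [NormedRing B] [StarRing B] [CStarRing B]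
    [Nontrivial B] [NormedAlgebra ℂ B] {d : ℕ} [NeZero d] [Fact d.Prime] {h : ZMod d} (hh : h ≠ 0)
    (T : ZMod d → ZMod d → B) (h0 : T 0 0 = 1)
    (hmul : ∀ q p q' p', T q p * T q' p' =
      ZMod.stdAddChar (h * (p * q' - q * p')) • T (q + q') (p + p'))
    (hstar : ∀ q p, star (T q p) = T (-q) (-p)) :
    ‖∑ q, ∑ p, T q p‖ ≤ d := by
  set A := ∑ q, ∑ p, T q p with hA
  have hsum : star A * A = ((d : ℂ) ^ 2) • (1 : B) := by
    have hrow (q p) : T (-q) (-p) * A =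
        ∑ u, ∑ v, (ZMod.stdAddChar (p * (-(h * u))) * ZMod.stdAddChar (q * (h * v)) : ℂ) •
          T u v := by
      rw [hA, ← Equiv.sum_comp (Equiv.addRight q), Finset.mul_sum]
      refine Finset.sum_congr rfl fun u _ => ?_
      rw [← Equiv.sum_comp (Equiv.addRight p), Finset.mul_sum]
      refine Finset.sum_congr rfl fun v _ => ?_
      rw [hmul, ← AddChar.map_add_eq_mul]
      simp only [Equiv.coe_addRight]
      congr 2 <;> ring_nf
    have hψ := ZMod.isPrimitive_stdAddChar d
    calc star A * A = ∑ q, ∑ p, T (-q) (-p) * A := by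
          have hstarA : star A = ∑ q, ∑ p, T (-q) (-p) := by simp only [hA, star_sum, hstar]
          simp only [hstarA, Finset.sum_mul]
      _ = ∑ u, ∑ v, ((∑ p, ZMod.stdAddChar (p * (-(h * u)))) *
            (∑ q, ZMod.stdAddChar (q * (h * v))) : ℂ) • T u v := by
          simp only [hrow, Finset.sum_mul_sum, Finset.sum_smul]
          rw [Finset.sum_congr rfl fun q _ => Finset.sum_comm, Finset.sum_comm]
          refine Finset.sum_congr rfl fun u _ => ?_
          rw [Finset.sum_congr rfl fun q _ => Finset.sum_comm, Finset.sum_comm]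
          exact Finset.sum_congr rfl fun v _ => Finset.sum_comm
      _ = _ := by
          simp only [AddChar.sum_mulShift _ hψ, neg_eq_zero, mul_eq_zero, hh, false_or, ZMod.card]
          rw [Finset.sum_eq_single 0, Finset.sum_eq_single 0]
          · simp [h0, sq]
          all_goals simp +contextual
  have hsq : ‖A‖ * ‖A‖ ≤ d * d := by
    rw [← CStarRing.norm_star_mul_self, hsum]
    refine (norm_smul_le _ _).trans ?_
    rw [norm_pow, Complex.norm_natCast, ← sq]
    rw [CStarRing.norm_one, mul_one]
  exact abs_le_of_sq_le_sq' (by simpa [sq] using hsq) (by positivity) |>.2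

section Displacement

variable (d : ℕ) [NeZero d]

theorem omega_pow_val (j : ZMod d) : omega d ^ j.val = ZMod.stdAddChar j := by
  conv_rhs => rw [← ZMod.natCast_zmod_val j, ← Int.cast_natCast, ZMod.stdAddChar_coe]
  rw [omega, ← Complex.exp_nat_mul]
  congr 1
  push_cast
  ring

theorem Xmat_zpow (q : ℤ) :
    Xmat d ^ q = Matrix.of fun i j : ZMod d => if i = j + q then (1 : ℂ) else 0 := by
  have := Matrix.zpow_eq_of_map_add
    (fun q : ℤ => Matrix.of fun i j : ZMod d => if i = j + q then (1 : ℂ) else 0)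
    (by ext i j; simp [Matrix.one_apply])
    (fun a b => by
      ext i j
      simp only [Matrix.mul_apply, Matrix.of_apply, mul_ite, mul_one, mul_zero,
        Finset.sum_ite_eq', Finset.mem_univ, if_true]
      push_cast
      congr 2
      ring) q
  simpa [Xmat] using this

theorem Zmat_zpow (p : ℤ) :
    Zmat d ^ p = Matrix.diagonal fun j : ZMod d => ZMod.stdAddChar ((p : ZMod d) * j) := by
  have := Matrix.zpow_eq_of_map_add
    (fun p : ℤ => Matrix.diagonal fun j : ZMod d => (ZMod.stdAddChar ((p : ZMod d) * j) : ℂ))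
    (by simp)
    (fun a b => by simp [Matrix.diagonal_mul_diagonal, add_mul, AddChar.map_add_eq_mul]) p
  simpa [Zmat, omega_pow_val] using this

theorem Dmat_apply (q p : ℤ) (i j : ZMod d) :
    Dmat d q p i j = if i = j + q then
      Complex.exp (Real.pi * Complex.I * q * p / d) * ZMod.stdAddChar ((p : ZMod d) * j) else 0 := by
  simp [Dmat, Xmat_zpow, Zmat_zpow, Matrix.mul_diagonal]

theorem Dmat_zero : Dmat d 0 0 = 1 := by
  ext i j
  simp [Dmat_apply, Matrix.one_apply]

theorem Dmat_mul (q p q' p' : ℤ) :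
    Dmat d q p * Dmat d q' p' =
      Complex.exp (Real.pi * Complex.I * (p * q' - q * p') / d) • Dmat d (q + q') (p + p') := by
  ext i j
  simp only [Matrix.mul_apply, Dmat_apply, Matrix.smul_apply, smul_eq_mul, mul_ite, mul_zero,
    Finset.sum_ite_eq', Finset.mem_univ, if_true]
  have hij : (i = j + q' + q) ↔ (i = j + ((q + q' : ℤ) : ZMod d)) := by
    push_cast
    rw [add_assoc, add_comm (q' : ZMod d)]
  simp only [hij, ite_mul, zero_mul]
  split_ifs
  · have hpq : (ZMod.stdAddChar (p * (j + q') : ZMod d) : ℂ) =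
        ZMod.stdAddChar (p * j : ZMod d) * Complex.exp (2 * Real.pi * Complex.I * (p * q') / d) := by
      rw [mul_add, AddChar.map_add_eq_mul, ← Int.cast_mul p q', ZMod.stdAddChar_coe]
      push_cast
      rfl
    rw [hpq]
    push_cast
    rw [add_mul (p : ZMod d), AddChar.map_add_eq_mul]
    have hexp : Complex.exp (Real.pi * Complex.I * q * p / d) *
        Complex.exp (2 * Real.pi * Complex.I * (p * q') / d) *
        Complex.exp (Real.pi * Complex.I * q' * p' / d) =
        Complex.exp (Real.pi * Complex.I * (p * q' - q * p') / d) *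
        Complex.exp (Real.pi * Complex.I * (q + q') * (p + p') / d) := by
      simp only [← Complex.exp_add]
      congr 1
      ring
    linear_combination (ZMod.stdAddChar (p * j : ZMod d) * ZMod.stdAddChar (p' * j : ZMod d)) * hexp
  · rfl

theorem Dmat_conjTranspose (q p : ℤ) : (Dmat d q p)ᴴ = Dmat d (-q) (-p) := by
  ext i j
  have hij : (j = i + q) ↔ (i = j + ((-q : ℤ) : ZMod d)) := by
    push_cast
    rw [← sub_eq_add_neg, eq_sub_iff_add_eq, eq_comm]
  simp only [Matrix.conjTranspose_apply, Dmat_apply, hij]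
  split_ifs with h
  · rw [star_mul', Complex.star_def, ← Complex.exp_conj, ← AddChar.map_neg_eq_conj,
      h, show -((p : ZMod d) * (j + ((-q : ℤ) : ZMod d))) =
        ((p * q : ℤ) : ZMod d) + ((-p : ℤ) : ZMod d) * j by push_cast; ring,
      AddChar.map_add_eq_mul, ZMod.stdAddChar_coe, ← mul_assoc, ← Complex.exp_add]
    congr 2
    simp
    ring
  · simp

theorem Dmat_add_mul (q p m n : ℤ) :
    Dmat d (q + d * m) (p + d * n) = (-1 : ℂ) ^ (q * n + m * p + d * m * n) • Dmat d q p := by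
  ext i j
  have hd : (d : ℂ) ≠ 0 := NeZero.ne _
  simp only [Matrix.smul_apply, Dmat_apply, Int.cast_add, Int.cast_mul, Int.cast_natCast,
    CharP.cast_eq_zero, zero_mul, add_zero, smul_eq_mul, mul_ite, mul_zero]
  rw [← mul_assoc, ← Complex.exp_pi_mul_I, ← Complex.exp_int_mul, ← Complex.exp_add]
  congr 3
  push_cast
  field_simp
  ring

/-- The tensor product of the displacement operators `D_{s_t q, s_t p}` for signs `s_t`. -/
noncomputable def signedDisplacement {ι : Type*} [Fintype ι] (s : ι → ℤˣ) (q p : ℤ) :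
    Matrix (ι → ZMod d) (ι → ZMod d) ℂ :=
  Matrix.piKronecker fun t => Dmat d (s t * q) (s t * p)

section Signed

variable {ι : Type*} [Fintype ι] (s : ι → ℤˣ)

theorem units_mul_mul_units_mul (u : ℤˣ) (a b : ℤ) : (u * a) * (u * b) = a * b := by
  rcases Int.units_eq_one_or u with rfl | rfl <;> simp

theorem signedDisplacement_zero : signedDisplacement d s 0 0 = 1 := by
  simp [signedDisplacement, Dmat_zero, Matrix.piKronecker_one]

theorem signedDisplacement_mul [DecidableEq ι] {h : ℕ} (hh : Fintype.card ι = h + h)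
    (q p q' p' : ℤ) :
    signedDisplacement d s q p * signedDisplacement d s q' p' =
      ZMod.stdAddChar ((h * (p * q' - q * p') : ℤ) : ZMod d) •
        signedDisplacement d s (q + q') (p + p') := by
  have hphase (u : ℤˣ) : (((u * p : ℤ) : ℂ) * ((u * q' : ℤ) : ℂ) -
      ((u * q : ℤ) : ℂ) * ((u * p' : ℤ) : ℂ)) = p * q' - q * p' := by
    rw [← Int.cast_mul, ← Int.cast_mul, units_mul_mul_units_mul, units_mul_mul_units_mul]
    push_cast
    rfl
  simp only [signedDisplacement, Matrix.piKronecker_mul, Dmat_mul, Matrix.piKronecker_smul,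
    ← mul_add, hphase]
  rw [ZMod.stdAddChar_coe, Finset.prod_const, Finset.card_univ, hh, ← Complex.exp_nat_mul]
  congr 2
  push_cast
  ring

theorem signedDisplacement_conjTranspose (q p : ℤ) :
    (signedDisplacement d s q p)ᴴ = signedDisplacement d s (-q) (-p) := by
  simp [signedDisplacement, Matrix.piKronecker_conjTranspose, Dmat_conjTranspose]

theorem signedDisplacement_congr (hι : Even (Fintype.card ι)) {q p q' p' : ℤ}
    (hq : (q : ZMod d) = q') (hp : (p : ZMod d) = p') :
    signedDisplacement d s q p = signedDisplacement d s q' p' := by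
  obtain ⟨m, hm⟩ := (ZMod.intCast_eq_intCast_iff_dvd_sub _ _ _).1 hq
  obtain ⟨n, hn⟩ := (ZMod.intCast_eq_intCast_iff_dvd_sub _ _ _).1 hp
  obtain rfl : q' = q + d * m := by linarith
  obtain rfl : p' = p + d * n := by linarith
  have hterm (u : ℤˣ) : Dmat d (u * (q + d * m)) (u * (p + d * n)) =
      (-1 : ℂ) ^ (q * n + m * p + d * m * n) • Dmat d (u * q) (u * p) := by
    rw [mul_add, mul_add, mul_left_comm, mul_left_comm _ _ n, Dmat_add_mul,
      units_mul_mul_units_mul, units_mul_mul_units_mul, mul_assoc (d : ℤ),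
      units_mul_mul_units_mul, ← mul_assoc]
  simp only [signedDisplacement, hterm]
  rw [Matrix.piKronecker_smul, Finset.prod_const, Finset.card_univ, ← zpow_natCast, zpow_comm,
    zpow_natCast, hι.neg_one_pow, _root_.one_zpow, one_smul]

open scoped Matrix.Norms.L2Operator in
theorem norm_sum_signedDisplacement_le [DecidableEq ι] [Fact d.Prime] {h : ℕ}
    (hh : Fintype.card ι = h + h) (hd : ¬ d ∣ h) :
    ‖∑ q : ZMod d, ∑ p : ZMod d, signedDisplacement d s q.val p.val‖ ≤ d := by
  refine norm_sum_twisted_le (h := (h : ZMod d))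
    (by rwa [Ne, ZMod.natCast_eq_zero_iff])
    (fun q p => signedDisplacement d s q.val p.val) ?_ (fun q p q' p' => ?_) (fun q p => ?_)
  · simp [signedDisplacement_zero]
  · rw [signedDisplacement_mul d s hh]
    refine congrArg₂ _ (by simp) (signedDisplacement_congr d s ⟨h, hh⟩ ?_ ?_) <;> simp
  · rw [Matrix.star_eq_conjTranspose, signedDisplacement_conjTranspose]
    refine signedDisplacement_congr d s ⟨h, hh⟩ ?_ ?_ <;> simp

end Signed

/-- The coefficient of `D_{u q, u p}` in `E_{q,p}`. -/
noncomputable def signCoeff (u : ℤˣ) : ℂ := (1 + u * Complex.I) / 2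

theorem norm_signCoeff (u : ℤˣ) : ‖signCoeff u‖ = (√2)⁻¹ := by
  have h2 : ‖signCoeff u‖ ^ 2 = ((√2)⁻¹) ^ 2 := by
    rw [← Complex.normSq_eq_norm_sq, inv_pow, Real.sq_sqrt zero_le_two]
    rcases Int.units_eq_one_or u with rfl | rfl <;>
      norm_num [signCoeff, Complex.normSq_apply]
  exact (pow_left_inj₀ (norm_nonneg _) (by positivity) two_ne_zero).1 h2

theorem Emat_eq_sum (q p : ℤ) :
    Emat d q p = ∑ u : ℤˣ, signCoeff u • Dmat d (u * q) (u * p) := by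
  rw [UnitsInt.univ, Finset.sum_pair (by decide)]
  simp [Emat, signCoeff, Complex.conj_ofNat]

theorem EtensorPow_eq_sum (k : ℕ) (q p : ℤ) :
    EtensorPow d k q p =
      ∑ s : Fin k → ℤˣ, (∏ t, signCoeff (s t)) • signedDisplacement d s q p := by
  simp only [signedDisplacement, ← Matrix.piKronecker_smul]
  rw [← Matrix.piKronecker_sum fun (_ : Fin k) u => signCoeff u • Dmat d (u * q) (u * p)]
  simp only [← Emat_eq_sum]
  rfl

open scoped Matrix.Norms.L2Operator in
theorem norm_sum_EtensorPow_le [Fact d.Prime] {h : ℕ} (hdk : ¬ d ∣ h) :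
    ‖∑ q : ZMod d, ∑ p : ZMod d, EtensorPow d (2 * h) q.val p.val‖ ≤ 2 ^ h * d := by
  have hexpand : ∑ q : ZMod d, ∑ p : ZMod d, EtensorPow d (2 * h) q.val p.val =
      ∑ s : Fin (2 * h) → ℤˣ, (∏ t, signCoeff (s t)) •
        ∑ q : ZMod d, ∑ p : ZMod d, signedDisplacement d s q.val p.val := by
    simp only [EtensorPow_eq_sum, Finset.smul_sum]
    rw [Finset.sum_congr rfl fun q _ => Finset.sum_comm, Finset.sum_comm]
  rw [hexpand]
  have hterm (s : Fin (2 * h) → ℤˣ) :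
      ‖(∏ t, signCoeff (s t)) •
        ∑ q : ZMod d, ∑ p : ZMod d, signedDisplacement d s q.val p.val‖ ≤ (2 ^ h)⁻¹ * d := by
    refine (norm_smul_le _ _).trans (mul_le_mul (le_of_eq ?_)
      (norm_sum_signedDisplacement_le d s (by simp [two_mul]) hdk) (norm_nonneg _) (by positivity))
    simp [norm_prod, norm_signCoeff, pow_mul]
  refine (norm_sum_le_of_le _ fun s _ => hterm s).trans (le_of_eq ?_)
  simp only [Finset.sum_const, Finset.card_univ, Fintype.card_fun, Fintype.card_units_int,
    Fintype.card_fin, nsmul_eq_mul]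
  push_cast
  rw [two_mul, pow_add]
  field_simp

end Displacement

theorem observable_sum_norm_bound (d : ℕ) [NeZero d] (hp : d.Prime)
    (k : ℕ) (hk : 0 < k) (hke : Even k) (hdk : ¬ (d ∣ k / 2)) :
    ‖Matrix.toEuclideanCLM (𝕜 := ℂ)
        (∑ q : ZMod d, ∑ p : ZMod d, EtensorPow d k q.val p.val)‖ ≤
      2 ^ (k / 2) * d := by
  obtain ⟨h, rfl⟩ := hke
  have : Fact d.Prime := ⟨hp⟩
  rw [← two_mul, Nat.mul_div_cancel_left h two_pos] at *
  exact (Matrix.l2_opNorm_toEuclideanCLM _).trans_le (norm_sum_EtensorPow_le d hdk)
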